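/- Let n ≥ 1 and Q = 2n+2. For every q ≥ Q there exists a constant C = C(n,q) such that for all u ∈ C_c^∞(ℝ^{2n+1}), (∫_{ℍ^n} |u|^q dξ)^{1/q} ≤ C (∫_{ℍ^n} (|∇_H u|^Q + |u|^Q) dξ)^{1/Q}; i.e., W^{1,Q}(ℍ^n) is continuously embedded in L^q(ℍ^n) for every q ≥ Q. -/

import Mathlib

open MeasureTheory Real ENNReal

noncomputable section

/-- The Heisenberg group `ℍ^n` as the underlying space `ℝ^n × ℝ^n × ℝ`. -/
abbrev Heis (n : ℕ) := (Fin n → ℝ) × (Fin n → ℝ) × ℝ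

/-- Heisenberg group law: `(x,y,t)∘(x',y',t') = (x+x', y+y', t+t'+2(⟨y,x'⟩−⟨x,y'⟩))`. -/
def hMul {n : ℕ} (ξ η : Heis n) : Heis n :=
  (ξ.1 + η.1, ξ.2.1 + η.2.1,
    ξ.2.2 + η.2.2 + 2 * ((∑ i, ξ.2.1 i * η.1 i) - ∑ i, ξ.1 i * η.2.1 i))

/-- Homogeneous norm `|ξ|_h = ((|x|²+|y|²)² + t²)^{1/4}`. -/
def hNorm {n : ℕ} (ξ : Heis n) : ℝ :=
  ((∑ i, ((ξ.1 i) ^ 2 + (ξ.2.1 i) ^ 2)) ^ 2 + (ξ.2.2) ^ 2) ^ ((1 : ℝ) / 4)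

/-- Heisenberg distance `d_h(ξ,η) = |η⁻¹∘ξ|_h`, where `η⁻¹ = -η`. -/
def hDist {n : ℕ} (ξ η : Heis n) : ℝ := hNorm (hMul (-η) ξ)

/-- Heisenberg ball `B_h(ξ,r) = {η : d_h(η,ξ) < r}`. -/
def hBall {n : ℕ} (ξ : Heis n) (r : ℝ) : Set (Heis n) := {η | hDist η ξ < r}

/-- Left-invariant vector field `X_i u = ∂u/∂x_i + 2 y_i ∂u/∂t`. -/
def Xd {n : ℕ} (u : Heis n → ℝ) (i : Fin n) (ξ : Heis n) : ℝ :=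
  fderiv ℝ u ξ (Pi.single i 1, 0, 0) + 2 * ξ.2.1 i * fderiv ℝ u ξ (0, 0, 1)

/-- Left-invariant vector field `Y_i u = ∂u/∂y_i − 2 x_i ∂u/∂t`. -/
def Yd {n : ℕ} (u : Heis n → ℝ) (i : Fin n) (ξ : Heis n) : ℝ :=
  fderiv ℝ u ξ (0, Pi.single i 1, 0) - 2 * ξ.1 i * fderiv ℝ u ξ (0, 0, 1)

/-- Norm of the sub-elliptic gradient `|∇_H u| = (Σ ((X_i u)² + (Y_i u)²))^{1/2}`. -/
def hGradNorm {n : ℕ} (u : Heis n → ℝ) (ξ : Heis n) : ℝ :=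
  Real.sqrt (∑ i, ((Xd u i ξ) ^ 2 + (Yd u i ξ) ^ 2))

/-- `ζ(Q,s) = e^s − Σ_{k=0}^{Q−2} s^k/k!`. -/
def zeta (Q : ℕ) (s : ℝ) : ℝ :=
  Real.exp s - ∑ k ∈ Finset.range (Q - 1), s ^ k / (Nat.factorial k)

/-- Surface area of the unit sphere in `ℝ^{2n}`: `ω_{2n-1} = 2π^n/(n-1)!`. -/
def omegaSphere (n : ℕ) : ℝ := 2 * Real.pi ^ n / (Nat.factorial (n - 1))

/-- `σ_Q = Γ(1/2) Γ(n+1/2) ω_{2n-1} / n!`. -/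
def sigmaQ (n : ℕ) : ℝ :=
  Real.Gamma (1 / 2) * Real.Gamma (n + 1 / 2) * omegaSphere n / (Nat.factorial n)

/-- `α_Q = Q σ_Q^{1/(Q-1)}` with `Q = 2n+2`. -/
def alphaQ (n : ℕ) : ℝ := (2 * n + 2) * (sigmaQ n) ^ ((1 : ℝ) / (2 * n + 1))

open Module in
lemma lintegral_comp_add_smul {E : Type*} [NormedAddCommGroup E] [NormedSpace ℝ E]
    [FiniteDimensional ℝ E] [MeasurableSpace E] [BorelSpace E] (μ : Measure E)
    [μ.IsAddHaarMeasure] {f : E → ℝ≥0∞} (hf : Measurable f) (a : E) {s : ℝ} (hs : 0 < s) :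
    ∫⁻ x, f (a + s • x) ∂μ = ENNReal.ofReal (s ^ finrank ℝ E)⁻¹ * ∫⁻ x, f x ∂μ := by
  have h := lintegral_map (μ := μ) (f := fun x ↦ f (a + x)) (g := fun x ↦ s • x)
    (by fun_prop) (by fun_prop)
  rw [← h, Measure.map_addHaar_smul μ hs.ne', lintegral_smul_measure,
    lintegral_add_left_eq_self, abs_of_pos (by positivity), smul_eq_mul]

/-- Tonelli's theorem on `ℍ^n`, one factor at a time. -/
lemma lintegral_heis {n : ℕ} {h : Heis n → ℝ≥0∞} (hh : Measurable h) :
    ∫⁻ w, h w = ∫⁻ x : Fin n → ℝ, ∫⁻ y : Fin n → ℝ, ∫⁻ t : ℝ, h (x, y, t) := by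
  rw [Measure.volume_eq_prod, lintegral_prod _ hh.aemeasurable]
  refine lintegral_congr fun x ↦ ?_
  rw [Measure.volume_eq_prod, lintegral_prod _ (by fun_prop)]

/-- Change of variables under a dilation followed by a shear and a translation. -/
lemma lintegral_comp_shear {n : ℕ} {h : Heis n → ℝ≥0∞} (hh : Measurable h)
    (a b : Fin n → ℝ) {c : (Fin n → ℝ) → (Fin n → ℝ) → ℝ}
    (hc : Measurable fun p : (Fin n → ℝ) × (Fin n → ℝ) ↦ c p.1 p.2) {s : ℝ} (hs : 0 < s) :
    ∫⁻ w : Heis n, h (a + s • w.1, b + s • w.2.1, c w.1 w.2.1 + s ^ 2 * w.2.2) =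
      ENNReal.ofReal (s ^ (2 * n + 2))⁻¹ * ∫⁻ w, h w := by
  have hc' : Measurable fun w : Heis n ↦ c w.1 w.2.1 :=
    hc.comp (f := fun w : Heis n ↦ (w.1, w.2.1)) (by fun_prop)
  rw [lintegral_heis (by fun_prop), lintegral_heis hh]
  have ht (x y : Fin n → ℝ) : ∫⁻ t : ℝ, h (a + s • x, b + s • y, c x y + s ^ 2 * t) =
      ENNReal.ofReal (s ^ 2)⁻¹ * ∫⁻ t : ℝ, h (a + s • x, b + s • y, t) := by
    have := lintegral_comp_add_smul volume (f := fun t ↦ h (a + s • x, b + s • y, t))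
      (by fun_prop) (c x y) (pow_pos hs 2)
    simpa using this
  have hm2 : Measurable fun p : (Fin n → ℝ) × (Fin n → ℝ) ↦ ∫⁻ t : ℝ, h (p.1, p.2, t) :=
    Measurable.lintegral_prod_right'
      (f := fun q : ((Fin n → ℝ) × (Fin n → ℝ)) × ℝ ↦ h (q.1.1, q.1.2, q.2)) (by fun_prop)
  have hy (x : Fin n → ℝ) : ∫⁻ y : Fin n → ℝ, ∫⁻ t : ℝ, h (a + s • x, b + s • y, t) =
      ENNReal.ofReal (s ^ n)⁻¹ * ∫⁻ y : Fin n → ℝ, ∫⁻ t : ℝ, h (a + s • x, y, t) := by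
    have := lintegral_comp_add_smul volume (f := fun y ↦ ∫⁻ t : ℝ, h (a + s • x, y, t))
      (hm2.comp (f := fun y ↦ (a + s • x, y)) (by fun_prop)) b hs
    simpa using this
  have hm1 : Measurable fun x : Fin n → ℝ ↦ ∫⁻ y : Fin n → ℝ, ∫⁻ t : ℝ, h (x, y, t) :=
    Measurable.lintegral_prod_right' hm2
  have hx := lintegral_comp_add_smul volume hm1 a hs
  have hm3 (x : Fin n → ℝ) :
      Measurable fun y : Fin n → ℝ ↦ ∫⁻ t : ℝ, h (a + s • x, b + s • y, t) :=
    hm2.comp (f := fun y ↦ (a + s • x, b + s • y)) (by fun_prop)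
  have hm4 : Measurable fun x : Fin n → ℝ ↦
      ∫⁻ y : Fin n → ℝ, ∫⁻ t : ℝ, h (a + s • x, y, t) :=
    hm1.comp (f := fun x ↦ a + s • x) (by fun_prop)
  have hm5 : Measurable fun x : Fin n → ℝ ↦
      ∫⁻ y : Fin n → ℝ, ∫⁻ t : ℝ, h (a + s • x, b + s • y, t) := by
    simp_rw [hy]; fun_prop
  simp_rw [ht, lintegral_const_mul _ (hm3 _)]
  rw [lintegral_const_mul _ hm5]
  simp_rw [hy]
  rw [lintegral_const_mul _ hm4, hx, ← mul_assoc, ← mul_assoc,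
    ← ENNReal.ofReal_mul (by positivity), ← ENNReal.ofReal_mul (by positivity)]
  congr 2
  simp only [Module.finrank_fintype_fun_eq_card, Fintype.card_fin]
  rw [← mul_inv, ← mul_inv]
  congr 1
  ring

/-- The Heisenberg dilation `δ_r(x,y,t) = (rx, ry, r²t)`. -/
def hDil {n : ℕ} (r : ℝ) (w : Heis n) : Heis n := (r • w.1, r • w.2.1, r ^ 2 * w.2.2)

lemma continuous_hMul {n : ℕ} : Continuous fun p : Heis n × Heis n ↦ hMul p.1 p.2 := by
  unfold hMul; fun_prop

lemma continuous_hDil {n : ℕ} : Continuous fun p : ℝ × Heis n ↦ hDil p.1 p.2 := by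
  unfold hDil; fun_prop

lemma lintegral_hMul_hDil {n : ℕ} {h : Heis n → ℝ≥0∞} (hh : Measurable h) (ξ : Heis n)
    {r : ℝ} (hr : 0 < r) :
    ∫⁻ w, h (hMul ξ (hDil r w)) = ENNReal.ofReal (r ^ (2 * n + 2))⁻¹ * ∫⁻ w, h w := by
  rw [← lintegral_comp_shear hh ξ.1 ξ.2.1 (c := fun x y ↦ ξ.2.2 +
    2 * ((∑ i, ξ.2.1 i * (r • x) i) - ∑ i, ξ.1 i * (r • y) i)) (by fun_prop) hr]
  refine lintegral_congr fun w ↦ ?_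
  simp only [hMul, hDil]
  congr 3
  ring

lemma lintegral_hMul_right {n : ℕ} {h : Heis n → ℝ≥0∞} (hh : Measurable h) (w : Heis n) :
    ∫⁻ ξ, h (hMul ξ w) = ∫⁻ ξ, h ξ := by
  have := lintegral_comp_shear hh w.1 w.2.1 (c := fun x y ↦ w.2.2 +
    2 * ((∑ i, y i * w.1 i) - ∑ i, x i * w.2.1 i)) (by fun_prop) one_pos
  simp only [one_pow, inv_one, ENNReal.ofReal_one, one_mul] at this
  rw [← this]
  refine lintegral_congr fun ξ ↦ ?_
  simp only [hMul, one_smul]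
  rw [add_comm w.1, add_comm w.2.1]
  congr 3
  ring

/-- The integral of `g` over the left translate by `ξ` of the `r`-dilated unit ball, rescaled. -/
def ballInt {n : ℕ} (g : Heis n → ℝ≥0∞) (r : ℝ) (ξ : Heis n) : ℝ≥0∞ :=
  ∫⁻ w in Metric.closedBall (0 : Heis n) 1, g (hMul ξ (hDil r w))

lemma measurable_ballInt {n : ℕ} {g : Heis n → ℝ≥0∞} (hg : Measurable g) :
    Measurable fun p : ℝ × Heis n ↦ ballInt g p.1 p.2 := by
  have h : Continuous fun q : (ℝ × Heis n) × Heis n ↦ hMul q.1.2 (hDil q.1.1 q.2) :=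
    continuous_hMul.comp (f := fun q : (ℝ × Heis n) × Heis n ↦ (q.1.2, hDil q.1.1 q.2))
      ((by fun_prop : Continuous fun q : (ℝ × Heis n) × Heis n ↦ q.1.2).prodMk
        (continuous_hDil.comp (f := fun q : (ℝ × Heis n) × Heis n ↦ (q.1.1, q.2)) (by fun_prop)))
  exact Measurable.lintegral_prod_right' (hg.comp h.measurable)

lemma measurable_hMul_hDil {n : ℕ} (ξ : Heis n) (r : ℝ) :
    Measurable fun w ↦ hMul ξ (hDil r w) := by
  unfold hMul hDil; fun_prop

lemma volume_closedBall_lt_top (n : ℕ) : volume (Metric.closedBall (0 : Heis n) 1) < ⊤ :=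
  measure_closedBall_lt_top

/-- Jensen's inequality for `ballInt`. -/
lemma ballInt_rpow_le {n : ℕ} {g : Heis n → ℝ≥0∞} (hg : Measurable g) (r : ℝ) (ξ : Heis n)
    {p : ℝ} (hp : 1 < p) :
    ballInt g r ξ ^ p ≤ volume (Metric.closedBall (0 : Heis n) 1) ^ (p - 1) *
      ballInt (fun w ↦ g w ^ p) r ξ := by
  have hpq : p.HolderConjugate (p / (p - 1)) := Real.HolderConjugate.conjExponent hp
  have hm := measurable_hMul_hDil ξ r
  have h := ENNReal.lintegral_mul_le_Lp_mul_Lq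
    (volume.restrict (Metric.closedBall (0 : Heis n) 1)) hpq
    (f := fun w ↦ g (hMul ξ (hDil r w))) (g := 1) (hg.comp hm).aemeasurable
    measurable_one.aemeasurable
  simp only [Pi.one_apply, ENNReal.one_rpow, lintegral_one, Measure.restrict_apply_univ,
    mul_one] at h
  have hp0 : 0 < p := by linarith
  calc ballInt g r ξ ^ p ≤ _ := ENNReal.rpow_le_rpow h hp0.le
    _ = _ := by
      rw [ENNReal.mul_rpow_of_nonneg _ _ hp0.le, ← ENNReal.rpow_mul, ← ENNReal.rpow_mul,
        mul_comm, ballInt]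
      congr 2
      · rw [one_div_div, div_mul_cancel₀ _ hp0.ne']
      · rw [one_div_mul_cancel hp0.ne', ENNReal.rpow_one]

lemma ballInt_le_lintegral {n : ℕ} {g : Heis n → ℝ≥0∞} (hg : Measurable g) {r : ℝ} (hr : 0 < r)
    (ξ : Heis n) : ballInt g r ξ ≤ ENNReal.ofReal (r ^ (2 * n + 2))⁻¹ * ∫⁻ w, g w := by
  rw [← lintegral_hMul_hDil hg ξ hr]
  exact setLIntegral_le_lintegral _ _

lemma lintegral_ballInt {n : ℕ} {g : Heis n → ℝ≥0∞} (hg : Measurable g) (r : ℝ) :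
    ∫⁻ ξ, ballInt g r ξ = volume (Metric.closedBall (0 : Heis n) 1) * ∫⁻ w, g w := by
  unfold ballInt
  rw [lintegral_lintegral_swap]
  · simp_rw [lintegral_hMul_right hg]
    rw [setLIntegral_const, mul_comm]
  · have : Measurable fun q : Heis n × Heis n ↦ hMul q.1 (hDil r q.2) := by
      unfold hMul hDil; fun_prop
    exact (hg.comp this).aemeasurable

/-- `L^Q → L^q` bound for `ballInt`, with the sharp power of the radius. -/
lemma lintegral_ballInt_rpow_le {n : ℕ} {g : Heis n → ℝ≥0∞} (hg : Measurable g) {q : ℝ}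
    (hq : (2 * n + 2 : ℝ) ≤ q) {r : ℝ} (hr : 0 < r) :
    ∫⁻ ξ, ballInt g r ξ ^ q ≤ ENNReal.ofReal (r ^ (-(q - (2 * n + 2)))) *
      (volume (Metric.closedBall (0 : Heis n) 1) ^ ((2 * n + 2 - 1) * q / (2 * n + 2) + 1) *
        (∫⁻ w, g w ^ (2 * n + 2 : ℝ)) ^ (q / (2 * n + 2))) := by
  set Q : ℝ := 2 * n + 2 with hQ
  set b := volume (Metric.closedBall (0 : Heis n) 1)
  set A := ∫⁻ w, g w ^ Q
  have hn : (0 : ℝ) ≤ n := n.cast_nonneg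
  have hQ1 : 1 < Q := by linarith
  have hQ0 : 0 < Q := by linarith
  set R := ENNReal.ofReal (r ^ (-(q - Q)))
  have hgQ : Measurable fun w ↦ g w ^ Q := by fun_prop
  have hsup (ξ : Heis n) : ballInt g r ξ ^ (q - Q) ≤ (b ^ (Q - 1) * A) ^ ((q - Q) / Q) * R := by
    have h1 : ballInt g r ξ ^ Q ≤ (b ^ (Q - 1) * A) * ENNReal.ofReal (r ^ (-Q)) := by
      refine (ballInt_rpow_le hg r ξ hQ1).trans ?_
      rw [mul_assoc]
      gcongr
      refine (ballInt_le_lintegral hgQ hr ξ).trans_eq ?_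
      have hr' : r ^ (2 * n + 2) = r ^ Q := by rw [hQ]; norm_cast
      rw [mul_comm, Real.rpow_neg hr.le, hr']
    have h2 := ENNReal.rpow_le_rpow h1 (div_nonneg (sub_nonneg.2 hq) hQ0.le)
    rw [← ENNReal.rpow_mul, mul_div_cancel₀ _ hQ0.ne',
      ENNReal.mul_rpow_of_nonneg _ _ (div_nonneg (sub_nonneg.2 hq) hQ0.le),
      ENNReal.ofReal_rpow_of_pos (by positivity), ← Real.rpow_mul hr.le] at h2
    convert h2 using 4
    field_simp
  calc ∫⁻ ξ, ballInt g r ξ ^ q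
      ≤ ∫⁻ ξ, ((b ^ (Q - 1) * A) ^ ((q - Q) / Q) * R) *
          (b ^ (Q - 1) * ballInt (fun w ↦ g w ^ Q) r ξ) := by
        refine lintegral_mono fun ξ ↦ ?_
        rw [show q = (q - Q) + Q by ring, ENNReal.rpow_add_of_nonneg _ _ (by linarith) hQ0.le]
        rw [show q - Q + Q - Q = q - Q by ring]
        exact mul_le_mul' (hsup ξ) (ballInt_rpow_le hg r ξ hQ1)
    _ = ((b ^ (Q - 1) * A) ^ ((q - Q) / Q) * R) * (b ^ (Q - 1) * (b * A)) := by
        have hm : Measurable (ballInt (fun w ↦ g w ^ Q) r) :=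
          (measurable_ballInt hgQ).comp (f := fun ξ ↦ (r, ξ)) (by fun_prop)
        rw [lintegral_const_mul _ (by fun_prop), lintegral_const_mul _ hm,
          lintegral_ballInt hgQ]
    _ = R * (((b ^ (Q - 1)) ^ ((q - Q) / Q) * (b ^ (Q - 1) * b)) * (A ^ ((q - Q) / Q) * A)) := by
        rw [ENNReal.mul_rpow_of_nonneg _ _ (div_nonneg (sub_nonneg.2 hq) hQ0.le)]
        ring
    _ = _ := by
        have e1 : A ^ ((q - Q) / Q) * A = A ^ (q / Q) := by
          nth_rw 2 [← ENNReal.rpow_one A]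
          rw [← ENNReal.rpow_add_of_nonneg _ _ (div_nonneg (sub_nonneg.2 hq) hQ0.le) zero_le_one]
          congr 1
          field_simp
          ring
        have e2 : (b ^ (Q - 1)) ^ ((q - Q) / Q) * (b ^ (Q - 1) * b) =
            b ^ ((Q - 1) * q / Q + 1) := by
          nth_rw 3 [← ENNReal.rpow_one b]
          have : 0 ≤ (q - Q) / Q := div_nonneg (sub_nonneg.2 hq) hQ0.le
          rw [← ENNReal.rpow_mul, ← ENNReal.rpow_add_of_nonneg _ _ (by linarith) zero_le_one,
            ← ENNReal.rpow_add_of_nonneg _ _ (by apply mul_nonneg <;> linarith) (by linarith)]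
          congr 1
          field_simp
          ring
        rw [e1, e2]

/-- Hölder's inequality in the radius against an integrable power weight. -/
lemma exists_lintegral_Ioc_rpow_le {p q : ℝ} (hp : 1 < p) (hq : p ≤ q) :
    ∃ K : ℝ≥0∞, K ≠ ⊤ ∧ ∀ f : ℝ → ℝ≥0∞, Measurable f →
      (∫⁻ r in Set.Ioc (0 : ℝ) 1, f r) ^ q ≤
        K * ∫⁻ r in Set.Ioc (0 : ℝ) 1, ENNReal.ofReal (r ^ (q - p)) * f r ^ q := by
  have hq0 : 0 < q := by linarith
  have hpq : (q / (q - 1)).HolderConjugate q :=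
    (Real.HolderConjugate.conjExponent (by linarith : 1 < q)).symm
  have hint : IntegrableOn (fun r : ℝ ↦ r ^ (-((q - p) / (q - 1)))) (Set.Ioc 0 1) := by
    refine (intervalIntegrable_iff_integrableOn_Ioc_of_le zero_le_one).1
      (intervalIntegral.intervalIntegrable_rpow' ?_)
    rw [neg_lt_neg_iff, div_lt_one (by linarith)]
    linarith
  refine ⟨(∫⁻ r in Set.Ioc (0 : ℝ) 1, ENNReal.ofReal (r ^ (-((q - p) / (q - 1))))) ^ (q - 1),
    ENNReal.rpow_ne_top_of_nonneg (by linarith) hint.lintegral_lt_top.ne, fun f hf ↦ ?_⟩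
  set a := (q - p) / q
  have h := ENNReal.lintegral_mul_le_Lp_mul_Lq (volume.restrict (Set.Ioc (0 : ℝ) 1)) hpq
    (f := fun r ↦ ENNReal.ofReal (r ^ (-a))) (g := fun r ↦ ENNReal.ofReal (r ^ a) * f r)
    (by fun_prop) (by fun_prop)
  have e0 : ∫⁻ r in Set.Ioc (0 : ℝ) 1, f r = ∫⁻ r in Set.Ioc (0 : ℝ) 1,
      ((fun r ↦ ENNReal.ofReal (r ^ (-a))) * (fun r ↦ ENNReal.ofReal (r ^ a) * f r)) r := by
    refine setLIntegral_congr_fun measurableSet_Ioc fun r hr ↦ ?_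
    simp only [Pi.mul_apply]
    rw [← mul_assoc, ← ENNReal.ofReal_mul (Real.rpow_nonneg hr.1.le _), ← Real.rpow_add hr.1]
    simp
  have e1 : ∫⁻ r in Set.Ioc (0 : ℝ) 1, ENNReal.ofReal (r ^ (-a)) ^ (q / (q - 1)) =
      ∫⁻ r in Set.Ioc (0 : ℝ) 1, ENNReal.ofReal (r ^ (-((q - p) / (q - 1)))) := by
    refine setLIntegral_congr_fun measurableSet_Ioc fun r hr ↦ ?_
    rw [ENNReal.ofReal_rpow_of_pos (Real.rpow_pos_of_pos hr.1 _), ← Real.rpow_mul hr.1.le]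
    congr 2
    simp only [a]
    have : q - 1 ≠ 0 := by linarith
    field_simp
  have e2 : ∫⁻ r in Set.Ioc (0 : ℝ) 1, (ENNReal.ofReal (r ^ a) * f r) ^ q =
      ∫⁻ r in Set.Ioc (0 : ℝ) 1, ENNReal.ofReal (r ^ (q - p)) * f r ^ q := by
    refine setLIntegral_congr_fun measurableSet_Ioc fun r hr ↦ ?_
    rw [ENNReal.mul_rpow_of_nonneg _ _ hq0.le,
      ENNReal.ofReal_rpow_of_pos (Real.rpow_pos_of_pos hr.1 _), ← Real.rpow_mul hr.1.le,
      div_mul_cancel₀ _ hq0.ne']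
  rw [← e0, e1, e2] at h
  refine (ENNReal.rpow_le_rpow h hq0.le).trans_eq ?_
  rw [ENNReal.mul_rpow_of_nonneg _ _ hq0.le, ← ENNReal.rpow_mul, ← ENNReal.rpow_mul,
    one_div_mul_cancel hq0.ne', ENNReal.rpow_one, one_div_div, div_mul_cancel₀ _ hq0.ne']

instance isAddHaarMeasure_volume_heis (n : ℕ) :
    (volume : Measure (Heis n)).IsAddHaarMeasure := by
  have : (volume : Measure ((Fin n → ℝ) × ℝ)).IsAddHaarMeasure :=
    Measure.prod.instIsAddHaarMeasure volume volume
  exact Measure.prod.instIsAddHaarMeasure volume volume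

/-- The coordinate `x_i` on `ℍ^n`. -/
def coordX {n : ℕ} (i : Fin n) : Heis n →L[ℝ] ℝ :=
  (ContinuousLinearMap.proj (R := ℝ) (φ := fun _ : Fin n ↦ ℝ) i).comp
    (ContinuousLinearMap.fst ℝ _ _)

/-- The coordinate `y_i` on `ℍ^n`. -/
def coordY {n : ℕ} (i : Fin n) : Heis n →L[ℝ] ℝ :=
  (ContinuousLinearMap.proj (R := ℝ) (φ := fun _ : Fin n ↦ ℝ) i).comp
    ((ContinuousLinearMap.fst ℝ _ _).comp (ContinuousLinearMap.snd ℝ _ _))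

lemma hasFDerivAt_coordX {n : ℕ} (i : Fin n) (ξ : Heis n) :
    HasFDerivAt (fun η : Heis n ↦ η.1 i) (coordX i) ξ := (coordX i).hasFDerivAt

lemma hasFDerivAt_coordY {n : ℕ} (i : Fin n) (ξ : Heis n) :
    HasFDerivAt (fun η : Heis n ↦ η.2.1 i) (coordY i) ξ := (coordY i).hasFDerivAt

@[simp] lemma coordX_apply {n : ℕ} (i : Fin n) (ξ : Heis n) : coordX i ξ = ξ.1 i := rfl

@[simp] lemma coordY_apply {n : ℕ} (i : Fin n) (ξ : Heis n) : coordY i ξ = ξ.2.1 i := rfl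

lemma Xd_eq_fderiv {n : ℕ} (u : Heis n → ℝ) (i : Fin n) (ξ : Heis n) :
    Xd u i ξ = fderiv ℝ u ξ (Pi.single i 1, 0, 2 * ξ.2.1 i) := by
  have h : ((Pi.single i 1, 0, 2 * ξ.2.1 i) : Heis n) =
      (Pi.single i 1, 0, 0) + (2 * ξ.2.1 i) • (0, 0, 1) := by
    simp
  rw [h, map_add, map_smul, Xd, smul_eq_mul]

lemma Yd_eq_fderiv {n : ℕ} (u : Heis n → ℝ) (i : Fin n) (ξ : Heis n) :
    Yd u i ξ = fderiv ℝ u ξ (0, Pi.single i 1, -2 * ξ.1 i) := by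
  have h : ((0, Pi.single i 1, -2 * ξ.1 i) : Heis n) =
      (0, Pi.single i 1, 0) + (-2 * ξ.1 i) • (0, 0, 1) := by
    simp
  rw [h, map_add, map_smul, Yd, smul_eq_mul]
  ring

lemma contDiff_Xd {n : ℕ} {u : Heis n → ℝ} (hu : ContDiff ℝ (⊤ : ℕ∞) u) (i : Fin n) :
    ContDiff ℝ (⊤ : ℕ∞) (Xd u i) := by
  have h : ContDiff ℝ (⊤ : ℕ∞) (fderiv ℝ u) := hu.fderiv_right (by simp)
  unfold Xd; fun_prop

lemma contDiff_Yd {n : ℕ} {u : Heis n → ℝ} (hu : ContDiff ℝ (⊤ : ℕ∞) u) (i : Fin n) :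
    ContDiff ℝ (⊤ : ℕ∞) (Yd u i) := by
  have h : ContDiff ℝ (⊤ : ℕ∞) (fderiv ℝ u) := hu.fderiv_right (by simp)
  unfold Yd; fun_prop

lemma continuous_hGradNorm {n : ℕ} {u : Heis n → ℝ} (hu : ContDiff ℝ (⊤ : ℕ∞) u) :
    Continuous (hGradNorm u) := by
  have hX i := (contDiff_Xd hu i).continuous
  have hY i := (contDiff_Yd hu i).continuous
  unfold hGradNorm; fun_prop

lemma abs_Xd_le {n : ℕ} (u : Heis n → ℝ) (i : Fin n) (ξ : Heis n) :
    |Xd u i ξ| ≤ hGradNorm u ξ := by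
  refine Real.abs_le_sqrt (le_trans ?_ (Finset.single_le_sum (fun j _ ↦ ?_) (Finset.mem_univ i)))
  · nlinarith [sq_nonneg (Yd u i ξ)]
  · positivity

lemma abs_Yd_le {n : ℕ} (u : Heis n → ℝ) (i : Fin n) (ξ : Heis n) :
    |Yd u i ξ| ≤ hGradNorm u ξ := by
  refine Real.abs_le_sqrt (le_trans ?_ (Finset.single_le_sum (fun j _ ↦ ?_) (Finset.mem_univ i)))
  · nlinarith [sq_nonneg (Xd u i ξ)]
  · positivity

lemma integral_fderiv_apply_eq_zero {E : Type*} [NormedAddCommGroup E] [NormedSpace ℝ E]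
    [FiniteDimensional ℝ E] [MeasurableSpace E] [BorelSpace E] (μ : Measure E)
    [μ.IsAddHaarMeasure] {f : E → ℝ} (hf : ContDiff ℝ 1 f) (hc : HasCompactSupport f) (v : E) :
    ∫ x, fderiv ℝ f x v ∂μ = 0 := by
  have hd : Integrable (fun x ↦ fderiv ℝ f x v) μ :=
    ((hf.continuous_fderiv one_ne_zero).clm_apply continuous_const).integrable_of_hasCompactSupport
      (hc.fderiv_apply ℝ v)
  have h := integral_mul_fderiv_eq_neg_fderiv_mul_of_integrable (μ := μ) (𝕜 := ℝ)
    (f := fun _ ↦ (1 : ℝ)) (g := f) (v := v) (by simp) (by simpa using hd)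
    (by simpa using hf.continuous.integrable_of_hasCompactSupport hc) (by simp)
    (fun x _ ↦ hf.differentiable one_ne_zero x)
  simpa using h

lemma integral_Xd_eq_zero {n : ℕ} {f : Heis n → ℝ} (hf : ContDiff ℝ 1 f)
    (hc : HasCompactSupport f) (i : Fin n) : ∫ ξ, Xd f i ξ = 0 := by
  have hg : ContDiff ℝ 1 fun ξ : Heis n ↦ (2 * ξ.2.1 i) * f ξ := by fun_prop
  have hgc : HasCompactSupport fun ξ : Heis n ↦ (2 * ξ.2.1 i) * f ξ := hc.mul_left
  have he (ξ : Heis n) : Xd f i ξ = fderiv ℝ f ξ (Pi.single i 1, 0, 0) +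
      fderiv ℝ (fun ξ : Heis n ↦ (2 * ξ.2.1 i) * f ξ) ξ (0, 0, 1) := by
    have hfd : DifferentiableAt ℝ f ξ := hf.differentiable one_ne_zero ξ
    rw [(((hasFDerivAt_coordY i ξ).const_mul 2).fun_mul hfd.hasFDerivAt).fderiv, Xd]
    simp
  simp_rw [he]
  have hi {g : Heis n → ℝ} (hg : ContDiff ℝ 1 g) (hc : HasCompactSupport g) (v : Heis n) :
      Integrable fun ξ ↦ fderiv ℝ g ξ v :=
    ((hg.continuous_fderiv one_ne_zero).clm_apply
      continuous_const).integrable_of_hasCompactSupport (hc.fderiv_apply ℝ v)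
  rw [integral_add (hi hf hc _) (hi hg hgc _), integral_fderiv_apply_eq_zero _ hf hc,
    integral_fderiv_apply_eq_zero _ hg hgc, add_zero]

lemma integral_Yd_eq_zero {n : ℕ} {f : Heis n → ℝ} (hf : ContDiff ℝ 1 f)
    (hc : HasCompactSupport f) (i : Fin n) : ∫ ξ, Yd f i ξ = 0 := by
  have hg : ContDiff ℝ 1 fun ξ : Heis n ↦ (2 * ξ.1 i) * f ξ := by fun_prop
  have hgc : HasCompactSupport fun ξ : Heis n ↦ (2 * ξ.1 i) * f ξ := hc.mul_left
  have he (ξ : Heis n) : Yd f i ξ = fderiv ℝ f ξ (0, Pi.single i 1, 0) -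
      fderiv ℝ (fun ξ : Heis n ↦ (2 * ξ.1 i) * f ξ) ξ (0, 0, 1) := by
    have hfd : DifferentiableAt ℝ f ξ := hf.differentiable one_ne_zero ξ
    rw [(((hasFDerivAt_coordX i ξ).const_mul 2).fun_mul hfd.hasFDerivAt).fderiv, Yd]
    simp
  simp_rw [he]
  have hi {g : Heis n → ℝ} (hg : ContDiff ℝ 1 g) (hc : HasCompactSupport g) (v : Heis n) :
      Integrable fun ξ ↦ fderiv ℝ g ξ v :=
    ((hg.continuous_fderiv one_ne_zero).clm_apply
      continuous_const).integrable_of_hasCompactSupport (hc.fderiv_apply ℝ v)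
  rw [integral_sub (hi hf hc _) (hi hg hgc _), integral_fderiv_apply_eq_zero _ hf hc,
    integral_fderiv_apply_eq_zero _ hg hgc, sub_zero]

lemma Xd_mul {n : ℕ} {f g : Heis n → ℝ} {ξ : Heis n} (hf : DifferentiableAt ℝ f ξ)
    (hg : DifferentiableAt ℝ g ξ) (i : Fin n) :
    Xd (fun η ↦ f η * g η) i ξ = f ξ * Xd g i ξ + g ξ * Xd f i ξ := by
  simp [Xd_eq_fderiv, fderiv_fun_mul hf hg]

lemma Yd_mul {n : ℕ} {f g : Heis n → ℝ} {ξ : Heis n} (hf : DifferentiableAt ℝ f ξ)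
    (hg : DifferentiableAt ℝ g ξ) (i : Fin n) :
    Yd (fun η ↦ f η * g η) i ξ = f ξ * Yd g i ξ + g ξ * Yd f i ξ := by
  simp [Yd_eq_fderiv, fderiv_fun_mul hf hg]

/-- The commutation relation `[X_i, Y_i] = -4 ∂_t`. -/
lemma Xd_Yd_sub_Yd_Xd {n : ℕ} {v : Heis n → ℝ} (hv : ContDiff ℝ (⊤ : ℕ∞) v) (i : Fin n)
    (ξ : Heis n) : Xd (Yd v i) i ξ - Yd (Xd v i) i ξ = -4 * fderiv ℝ v ξ (0, 0, 1) := by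
  have hD : DifferentiableAt ℝ (fderiv ℝ v) ξ :=
    (hv.fderiv_right (m := 1) (by norm_cast)).differentiable one_ne_zero ξ
  have hsymm : IsSymmSndFDerivAt ℝ v ξ := hv.contDiffAt.isSymmSndFDerivAt (by simp; norm_cast)
  have hV : HasFDerivAt (fun η : Heis n ↦ ((0, Pi.single i 1, -2 * η.1 i) : Heis n))
      ((0 : Heis n →L[ℝ] (Fin n → ℝ)).prod ((0 : Heis n →L[ℝ] (Fin n → ℝ)).prod
        ((-2 : ℝ) • coordX i))) ξ :=
    (hasFDerivAt_const _ _).prodMk ((hasFDerivAt_const _ _).prodMk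
      ((hasFDerivAt_coordX i ξ).const_mul (-2 : ℝ)))
  have hW : HasFDerivAt (fun η : Heis n ↦ ((Pi.single i 1, 0, 2 * η.2.1 i) : Heis n))
      ((0 : Heis n →L[ℝ] (Fin n → ℝ)).prod ((0 : Heis n →L[ℝ] (Fin n → ℝ)).prod
        ((2 : ℝ) • coordY i))) ξ :=
    (hasFDerivAt_const _ _).prodMk ((hasFDerivAt_const _ _).prodMk
      ((hasFDerivAt_coordY i ξ).const_mul (2 : ℝ)))
  have hY : Yd v i = fun η ↦ fderiv ℝ v η (0, Pi.single i 1, -2 * η.1 i) :=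
    funext fun η ↦ Yd_eq_fderiv v i η
  have hX : Xd v i = fun η ↦ fderiv ℝ v η (Pi.single i 1, 0, 2 * η.2.1 i) :=
    funext fun η ↦ Xd_eq_fderiv v i η
  rw [Xd_eq_fderiv, Yd_eq_fderiv, hY, hX, (hD.hasFDerivAt.clm_apply hV).fderiv,
    (hD.hasFDerivAt.clm_apply hW).fderiv]
  have hs := hsymm (Pi.single i 1, 0, 2 * ξ.2.1 i) (0, Pi.single i 1, -2 * ξ.1 i)
  have h2 (c : ℝ) : fderiv ℝ v ξ (0, 0, c) = c * fderiv ℝ v ξ (0, 0, 1) := by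
    rw [← smul_eq_mul, ← map_smul]; simp
  simp only [add_apply, ContinuousLinearMap.comp_apply,
    ContinuousLinearMap.flip_apply, ContinuousLinearMap.prod_apply,
    zero_apply, smul_apply,
    coordX_apply, coordY_apply,
    Pi.single_eq_same, smul_eq_mul, hs, h2 (-2 * 1), h2 (2 * 1)]
  ring

/-- The generator of dilations in terms of the horizontal fields and `∂_t`. -/
lemma fderiv_apply_dilation {n : ℕ} (v : Heis n → ℝ) (w : Heis n) :
    fderiv ℝ v w (w.1, w.2.1, 2 * w.2.2) =
      (∑ i, (w.1 i * Xd v i w + w.2.1 i * Yd v i w)) + 2 * w.2.2 * fderiv ℝ v w (0, 0, 1) := by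
  have h : ((w.1, w.2.1, 2 * w.2.2) : Heis n) =
      (∑ i, (w.1 i • ((Pi.single i 1, 0, 2 * w.2.1 i) : Heis n) +
        w.2.1 i • ((0, Pi.single i 1, -2 * w.1 i) : Heis n))) +
        (2 * w.2.2) • ((0, 0, 1) : Heis n) := by
    ext j
    · simp [Prod.fst_sum, Finset.sum_apply, Pi.single_apply]
    · simp [Prod.fst_sum, Prod.snd_sum, Finset.sum_apply, Pi.single_apply]
    · have : ∀ i, w.1 i * (2 * w.2.1 i) + -(w.2.1 i * (2 * w.1 i)) = 0 := fun i ↦ by ring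
      simp [Prod.snd_sum, this]
  rw [h, map_add, map_sum, map_smul, smul_eq_mul]
  simp_rw [map_add, map_smul, smul_eq_mul, Xd_eq_fderiv, Yd_eq_fderiv]

/-- Integrating the dilation field against a test function costs only horizontal derivatives. -/
lemma integral_mul_fderiv_dilation {n : ℕ} {v φ : Heis n → ℝ} (hv : ContDiff ℝ (⊤ : ℕ∞) v)
    (hφ : ContDiff ℝ (⊤ : ℕ∞) φ) (hc : HasCompactSupport φ) (j : Fin n) :
    ∫ w, φ w * fderiv ℝ v w (w.1, w.2.1, 2 * w.2.2) =
      ∫ w, ((∑ i, (w.1 i * φ w * Xd v i w + w.2.1 i * φ w * Yd v i w)) +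
        1 / 2 * (Xd (fun w ↦ w.2.2 * φ w) j w * Yd v j w -
          Yd (fun w ↦ w.2.2 * φ w) j w * Xd v j w)) := by
  set g : Heis n → ℝ := fun w ↦ w.2.2 * φ w with hg
  have hgs : ContDiff ℝ (⊤ : ℕ∞) g := by fun_prop
  have hgc : HasCompactSupport g := hc.mul_left
  have hX := contDiff_Xd hv j
  have hY := contDiff_Yd hv j
  have hgY : ContDiff ℝ (⊤ : ℕ∞) fun w ↦ g w * Yd v j w := by fun_prop
  have hgX : ContDiff ℝ (⊤ : ℕ∞) fun w ↦ g w * Xd v j w := by fun_prop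
  have h1 := integral_Xd_eq_zero (hgY.of_le (by norm_cast)) hgc.mul_right j
  have h2 := integral_Yd_eq_zero (hgX.of_le (by norm_cast)) hgc.mul_right j
  have hcX {f : Heis n → ℝ} (hf : HasCompactSupport f) : HasCompactSupport (Xd f j) := by
    have := hf.fderiv (𝕜 := ℝ)
    refine this.mono fun x hx ↦ ?_
    contrapose! hx
    simp only [Function.notMem_support] at hx
    simp [Xd_eq_fderiv, hx]
  have hcY {f : Heis n → ℝ} (hf : HasCompactSupport f) : HasCompactSupport (Yd f j) := by
    have := hf.fderiv (𝕜 := ℝ)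
    refine this.mono fun x hx ↦ ?_
    contrapose! hx
    simp only [Function.notMem_support] at hx
    simp [Yd_eq_fderiv, hx]
  have i1 : Integrable (Xd (fun w ↦ g w * Yd v j w) j) :=
    (contDiff_Xd hgY j).continuous.integrable_of_hasCompactSupport (hcX hgc.mul_right)
  have i2 : Integrable (Yd (fun w ↦ g w * Xd v j w) j) :=
    (contDiff_Yd hgX j).continuous.integrable_of_hasCompactSupport (hcY hgc.mul_right)
  have i0 : Integrable fun w : Heis n ↦ φ w * fderiv ℝ v w (w.1, w.2.1, 2 * w.2.2) := by
    have : Continuous fun w : Heis n ↦ fderiv ℝ v w (w.1, w.2.1, 2 * w.2.2) :=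
      (hv.continuous_fderiv (by simp)).clm_apply (by fun_prop)
    exact (hφ.continuous.mul this).integrable_of_hasCompactSupport hc.mul_right
  have key (w : Heis n) : (∑ i, (w.1 i * φ w * Xd v i w + w.2.1 i * φ w * Yd v i w)) +
        1 / 2 * (Xd g j w * Yd v j w - Yd g j w * Xd v j w) =
      (φ w * fderiv ℝ v w (w.1, w.2.1, 2 * w.2.2) +
        1 / 2 * Xd (fun w ↦ g w * Yd v j w) j w) -
        1 / 2 * Yd (fun w ↦ g w * Xd v j w) j w := by
    have hd {f : Heis n → ℝ} (hf : ContDiff ℝ (⊤ : ℕ∞) f) : DifferentiableAt ℝ f w :=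
      hf.differentiable (by simp) w
    rw [Xd_mul (hd hgs) (hd hY), Yd_mul (hd hgs) (hd hX), fderiv_apply_dilation, mul_add,
      Finset.mul_sum]
    have hs : ∑ i, (w.1 i * φ w * Xd v i w + w.2.1 i * φ w * Yd v i w) =
        ∑ i, φ w * (w.1 i * Xd v i w + w.2.1 i * Yd v i w) :=
      Finset.sum_congr rfl fun i _ ↦ by ring
    have hcm := Xd_Yd_sub_Yd_Xd hv j w
    have hgw : g w = w.2.2 * φ w := rfl
    rw [hs]
    linear_combination (-1 / 2 * g w) * hcm + (-2 * fderiv ℝ v w (0, 0, 1)) * hgw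
  simp_rw [key]
  rw [integral_sub (f := fun w : Heis n ↦ φ w * fderiv ℝ v w (w.1, w.2.1, 2 * w.2.2) +
    1 / 2 * Xd (fun w ↦ g w * Yd v j w) j w) (i0.add (i1.const_mul _)) (i2.const_mul _),
    integral_add i0 (i1.const_mul _), integral_const_mul, integral_const_mul, h1, h2]
  simp

lemma exists_abs_integral_mul_fderiv_dilation_le {n : ℕ} (hn : 1 ≤ n) {φ : Heis n → ℝ}
    (hφ : ContDiff ℝ (⊤ : ℕ∞) φ) (hs : tsupport φ ⊆ Metric.closedBall 0 1) :
    ∃ M : ℝ, 0 ≤ M ∧ ∀ v : Heis n → ℝ, ContDiff ℝ (⊤ : ℕ∞) v →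
      ‖∫ w, φ w * fderiv ℝ v w (w.1, w.2.1, 2 * w.2.2)‖ₑ ≤
        ENNReal.ofReal M * ∫⁻ w in Metric.closedBall 0 1, ENNReal.ofReal (hGradNorm v w) := by
  have hc : HasCompactSupport φ :=
    HasCompactSupport.of_support_subset_isCompact (isCompact_closedBall 0 1)
      ((subset_tsupport φ).trans hs)
  let j : Fin n := ⟨0, hn⟩
  set g : Heis n → ℝ := fun w ↦ w.2.2 * φ w with hg
  have hgs : ContDiff ℝ (⊤ : ℕ∞) g := by fun_prop
  have hgB : tsupport g ⊆ Metric.closedBall 0 1 := (tsupport_mul_subset_right).trans hs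
  have h0 {w : Heis n} (hw : w ∉ Metric.closedBall 0 1) : φ w = 0 :=
    image_eq_zero_of_notMem_tsupport fun h ↦ hw (hs h)
  have hD0 {w : Heis n} (hw : w ∉ Metric.closedBall 0 1) : fderiv ℝ g w = 0 := by
    by_contra h
    exact hw (hgB (support_fderiv_subset ℝ (f := g) h))
  have hbdd {f : Heis n → ℝ} (hf : Continuous f) :
      ∃ C, 0 ≤ C ∧ ∀ w ∈ Metric.closedBall (0 : Heis n) 1, |f w| ≤ C := by
    obtain ⟨C, hC⟩ := (isCompact_closedBall (0 : Heis n) 1).exists_bound_of_continuousOn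
      hf.continuousOn
    exact ⟨|C|, abs_nonneg C, fun w hw ↦ (hC w hw).trans (le_abs_self C)⟩
  obtain ⟨A, hA0, hA⟩ := hbdd (f := fun w ↦ ∑ i, (|w.1 i * φ w| + |w.2.1 i * φ w|)) (by
    have := hφ.continuous
    fun_prop)
  obtain ⟨B, hB0, hB⟩ := hbdd (contDiff_Xd hgs j).continuous
  obtain ⟨C, hC0, hC⟩ := hbdd (contDiff_Yd hgs j).continuous
  refine ⟨A + 1 / 2 * (B + C), by positivity, fun v hv ↦ ?_⟩
  rw [integral_mul_fderiv_dilation hv hφ hc j]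
  refine (enorm_integral_le_lintegral_enorm _).trans ?_
  rw [← lintegral_const_mul _ (by have := (continuous_hGradNorm hv).measurable; fun_prop),
    ← lintegral_indicator Metric.isClosed_closedBall.measurableSet]
  refine lintegral_mono fun w ↦ ?_
  by_cases hw : w ∈ Metric.closedBall (0 : Heis n) 1
  · rw [Set.indicator_of_mem hw, ← ENNReal.ofReal_mul (by positivity), ← ofReal_norm]
    refine ENNReal.ofReal_le_ofReal ?_
    have hG : 0 ≤ hGradNorm v w := Real.sqrt_nonneg _
    rw [Real.norm_eq_abs, add_mul]
    refine (abs_add_le _ _).trans (add_le_add ?_ ?_)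
    · calc _ ≤ ∑ i, |w.1 i * φ w * Xd v i w + w.2.1 i * φ w * Yd v i w| :=
            Finset.abs_sum_le_sum_abs _ _
        _ ≤ ∑ i, (|w.1 i * φ w| + |w.2.1 i * φ w|) * hGradNorm v w := by
            refine Finset.sum_le_sum fun i _ ↦ (abs_add_le _ _).trans ?_
            rw [abs_mul (w.1 i * φ w), abs_mul (w.2.1 i * φ w), add_mul]
            gcongr
            · exact abs_Xd_le v i w
            · exact abs_Yd_le v i w
        _ ≤ _ := by
            rw [← Finset.sum_mul]
            gcongr
            exact (le_abs_self _).trans (hA w hw)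
    · rw [abs_mul, abs_of_pos (by norm_num : (0 : ℝ) < 1 / 2), mul_assoc, add_mul]
      gcongr
      refine (abs_sub _ _).trans ?_
      rw [abs_mul, abs_mul]
      gcongr
      · exact hB w hw
      · exact abs_Yd_le v j w
      · exact hC w hw
      · exact abs_Xd_le v j w
  · rw [Set.indicator_of_notMem hw]
    rw [Xd_eq_fderiv g, Yd_eq_fderiv g, hD0 hw]
    simp [h0 hw]

/-- The differential of `w ↦ ξ ∘ δ_r w`. -/
def hDiff {n : ℕ} (ξ : Heis n) (r : ℝ) : Heis n →L[ℝ] Heis n :=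
  (r • ContinuousLinearMap.fst ℝ _ _).prod
    ((r • (ContinuousLinearMap.fst ℝ _ _).comp (ContinuousLinearMap.snd ℝ _ _)).prod
      (r ^ 2 • (ContinuousLinearMap.snd ℝ _ _).comp (ContinuousLinearMap.snd ℝ _ _) +
        (2 * r) • ∑ i, (ξ.2.1 i • coordX i - ξ.1 i • coordY i)))

lemma hDiff_apply {n : ℕ} (ξ : Heis n) (r : ℝ) (a : Heis n) :
    hDiff ξ r a = (r • a.1, r • a.2.1,
      r ^ 2 * a.2.2 + 2 * r * ∑ i, (ξ.2.1 i * a.1 i - ξ.1 i * a.2.1 i)) := by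
  simp [hDiff]

lemma hMul_hDil {n : ℕ} (ξ : Heis n) (r : ℝ) (w : Heis n) :
    hMul ξ (hDil r w) = (ξ.1 + r • w.1, ξ.2.1 + r • w.2.1,
      ξ.2.2 + (r ^ 2 * w.2.2 + 2 * r * ∑ i, (ξ.2.1 i * w.1 i - ξ.1 i * w.2.1 i))) := by
  simp only [hMul, hDil, Pi.smul_apply, smul_eq_mul]
  congr 2
  rw [Finset.mul_sum, ← Finset.sum_sub_distrib, Finset.mul_sum, add_assoc]
  congr 2
  refine Finset.sum_congr rfl fun i _ ↦ ?_
  ring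

lemma fderiv_comp_hMul_hDil {n : ℕ} {u : Heis n → ℝ} (hu : ContDiff ℝ (⊤ : ℕ∞) u) (ξ : Heis n)
    (r : ℝ) (w a : Heis n) :
    fderiv ℝ (fun w ↦ u (hMul ξ (hDil r w))) w a =
      fderiv ℝ u (hMul ξ (hDil r w)) (hDiff ξ r a) := by
  have hp : HasFDerivAt (fun w ↦ hMul ξ (hDil r w)) (hDiff ξ r) w := by
    have : (fun w ↦ hMul ξ (hDil r w)) = fun w ↦ ξ + hDiff ξ r w := by
      funext w
      rw [hMul_hDil, hDiff_apply]
      rfl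
    rw [this]
    exact (hDiff ξ r).hasFDerivAt.const_add ξ
  have h := (hu.differentiable (by simp) (hMul ξ (hDil r w))).hasFDerivAt.comp w hp
  have h' : fderiv ℝ (fun w ↦ u (hMul ξ (hDil r w))) w = _ := h.fderiv
  rw [h']
  rfl

lemma contDiff_comp_hMul_hDil {n : ℕ} {u : Heis n → ℝ} (hu : ContDiff ℝ (⊤ : ℕ∞) u)
    (ξ : Heis n) (r : ℝ) : ContDiff ℝ (⊤ : ℕ∞) fun w ↦ u (hMul ξ (hDil r w)) := by
  simp_rw [hMul_hDil]
  fun_prop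

/-- The horizontal gradient is left-invariant and homogeneous of degree one under dilations. -/
lemma hGradNorm_comp_hMul_hDil {n : ℕ} {u : Heis n → ℝ} (hu : ContDiff ℝ (⊤ : ℕ∞) u)
    (ξ : Heis n) {r : ℝ} (hr : 0 ≤ r) (w : Heis n) :
    hGradNorm (fun w ↦ u (hMul ξ (hDil r w))) w = r * hGradNorm u (hMul ξ (hDil r w)) := by
  have hX (i : Fin n) : Xd (fun w ↦ u (hMul ξ (hDil r w))) i w =
      r * Xd u i (hMul ξ (hDil r w)) := by
    rw [Xd_eq_fderiv, Xd_eq_fderiv, fderiv_comp_hMul_hDil hu, ← smul_eq_mul r, ← map_smul,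
      hDiff_apply]
    congr 1
    simp only [hMul, hDil, Prod.smul_mk, Pi.add_apply, Pi.smul_apply, smul_eq_mul, smul_zero,
      Pi.zero_apply, mul_zero, sub_zero, Pi.single_apply, mul_ite, mul_one, Finset.sum_ite_eq',
      Finset.mem_univ, if_true]
    congr 2
    ring
  have hY (i : Fin n) : Yd (fun w ↦ u (hMul ξ (hDil r w))) i w =
      r * Yd u i (hMul ξ (hDil r w)) := by
    rw [Yd_eq_fderiv, Yd_eq_fderiv, fderiv_comp_hMul_hDil hu, ← smul_eq_mul r, ← map_smul,
      hDiff_apply]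
    congr 1
    simp only [hMul, hDil, Prod.smul_mk, Pi.add_apply, Pi.smul_apply, smul_eq_mul, smul_zero,
      Pi.zero_apply, mul_zero, zero_sub, Finset.sum_neg_distrib, Pi.single_apply, mul_ite,
      mul_one, Finset.sum_ite_eq', Finset.mem_univ, if_true]
    congr 2
    ring
  simp only [hGradNorm, hX, hY]
  have : ∑ i, ((r * Xd u i (hMul ξ (hDil r w))) ^ 2 + (r * Yd u i (hMul ξ (hDil r w))) ^ 2) =
      r ^ 2 * ∑ i, (Xd u i (hMul ξ (hDil r w)) ^ 2 + Yd u i (hMul ξ (hDil r w)) ^ 2) := by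
    rw [Finset.mul_sum]
    exact Finset.sum_congr rfl fun i _ ↦ by ring
  rw [this, Real.sqrt_mul (sq_nonneg r), Real.sqrt_sq hr]

/-- The velocity of the curve `r ↦ ξ ∘ δ_r w`. -/
def hVel {n : ℕ} (ξ : Heis n) (r : ℝ) (w : Heis n) : Heis n :=
  (w.1, w.2.1, 2 * r * w.2.2 + 2 * ∑ i, (ξ.2.1 i * w.1 i - ξ.1 i * w.2.1 i))

lemma hasDerivAt_comp_hMul_hDil {n : ℕ} {u : Heis n → ℝ} (hu : ContDiff ℝ (⊤ : ℕ∞) u)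
    (ξ w : Heis n) (r : ℝ) :
    HasDerivAt (fun r ↦ u (hMul ξ (hDil r w)))
      (fderiv ℝ u (hMul ξ (hDil r w)) (hVel ξ r w)) r := by
  have hp : HasDerivAt (fun r ↦ hMul ξ (hDil r w)) (hVel ξ r w) r := by
    simp_rw [hMul_hDil]
    have h1 : HasDerivAt (fun r : ℝ ↦ ξ.1 + r • w.1) w.1 r := by
      simpa using ((hasDerivAt_id r).smul_const w.1).const_add ξ.1
    have h2 : HasDerivAt (fun r : ℝ ↦ ξ.2.1 + r • w.2.1) w.2.1 r := by
      simpa using ((hasDerivAt_id r).smul_const w.2.1).const_add ξ.2.1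
    have h3 : HasDerivAt (fun r : ℝ ↦ ξ.2.2 + (r ^ 2 * w.2.2 +
        2 * r * ∑ i, (ξ.2.1 i * w.1 i - ξ.1 i * w.2.1 i))) (2 * r * w.2.2 +
          2 * ∑ i, (ξ.2.1 i * w.1 i - ξ.1 i * w.2.1 i)) r := by
      have a := (hasDerivAt_pow 2 r).mul_const w.2.2
      have b := ((hasDerivAt_id r).const_mul 2).mul_const
        (∑ i, (ξ.2.1 i * w.1 i - ξ.1 i * w.2.1 i))
      simpa using (a.add b).const_add ξ.2.2
    exact h1.prodMk (h2.prodMk h3)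
  exact (hu.differentiable (by simp) (hMul ξ (hDil r w))).hasFDerivAt.comp_hasDerivAt r hp

lemma hDiff_dilation {n : ℕ} (ξ : Heis n) (r : ℝ) (w : Heis n) :
    hDiff ξ r (w.1, w.2.1, 2 * w.2.2) = r • hVel ξ r w := by
  rw [hDiff_apply, hVel]
  simp only [Prod.smul_mk, smul_eq_mul]
  congr 2
  ring

/-- A bound for `u` by averages of `|u|` and of its horizontal gradient. -/
lemma exists_enorm_le_ballInt {n : ℕ} (hn : 1 ≤ n) :
    ∃ M : ℝ, 0 ≤ M ∧ ∀ u : Heis n → ℝ, ContDiff ℝ (⊤ : ℕ∞) u → ∀ ξ : Heis n,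
      ‖u ξ‖ₑ ≤ ENNReal.ofReal M * (ballInt (fun w ↦ ‖u w‖ₑ) 1 ξ +
        ∫⁻ r in Set.Ioc (0 : ℝ) 1, ballInt (fun w ↦ ENNReal.ofReal (hGradNorm u w)) r ξ) := by
  let b : ContDiffBump (0 : Heis n) := ⟨1 / 2, 1, by norm_num, by norm_num⟩
  set φ : Heis n → ℝ := b.normed volume with hφdef
  have hφ : ContDiff ℝ (⊤ : ℕ∞) φ := b.contDiff_normed
  have hφs : tsupport φ ⊆ Metric.closedBall 0 1 := b.tsupport_normed_eq.subset
  have hφc : HasCompactSupport φ := b.hasCompactSupport_normed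
  have hφ1 : ∫ w, φ w = 1 := b.integral_normed
  have h0 {w : Heis n} (hw : w ∉ Metric.closedBall 0 1) : φ w = 0 :=
    image_eq_zero_of_notMem_tsupport fun h ↦ hw (hφs h)
  obtain ⟨M₁, hM₁, hest⟩ := exists_abs_integral_mul_fderiv_dilation_le hn hφ hφs
  obtain ⟨M₂, hM₂⟩ := hφ.continuous.bounded_above_of_compact_support hφc
  refine ⟨max M₁ M₂, le_max_of_le_left hM₁, fun u hu ξ ↦ ?_⟩
  let F : ℝ → Heis n → ℝ := fun r w ↦ fderiv ℝ u (hMul ξ (hDil r w)) (hVel ξ r w)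
  have hpc : Continuous fun p : ℝ × Heis n ↦ hMul ξ (hDil p.1 p.2) := by
    unfold hMul hDil; fun_prop
  have hFc : Continuous fun p : ℝ × Heis n ↦ F p.1 p.2 :=
    ((hu.continuous_fderiv (by simp)).comp hpc).clm_apply (by unfold hVel; fun_prop)
  have hφF : Continuous fun p : ℝ × Heis n ↦ φ p.2 * F p.1 p.2 :=
    (hφ.continuous.comp continuous_snd).mul hFc
  have hint : Integrable (Function.uncurry fun r w ↦ φ w * F r w)
      ((volume.restrict (Set.Ioc (0 : ℝ) 1)).prod volume) := by
    have hK : IntegrableOn (fun p : ℝ × Heis n ↦ φ p.2 * F p.1 p.2)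
        (Set.Icc (0 : ℝ) 1 ×ˢ Metric.closedBall 0 1) (volume.prod volume) :=
      hφF.continuousOn.integrableOn_compact (isCompact_Icc.prod (isCompact_closedBall 0 1))
    have hK' := hK.mono_set (Set.prod_mono_left (t := Metric.closedBall (0 : Heis n) 1)
      (Set.Ioc_subset_Icc_self (a := (0 : ℝ)) (b := 1)))
    rw [IntegrableOn, ← Measure.prod_restrict] at hK'
    have hz : Function.support (Function.uncurry fun r w ↦ φ w * F r w) ⊆
        Set.univ ×ˢ Metric.closedBall (0 : Heis n) 1 := by
      intro p hp
      by_contra h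
      have : p.2 ∉ Metric.closedBall (0 : Heis n) 1 := fun h' ↦ h ⟨trivial, h'⟩
      exact hp (by simp [Function.uncurry, h0 this])
    rw [← integrableOn_iff_integrable_of_support_subset hz, IntegrableOn,
      ← Measure.prod_restrict, Measure.restrict_univ]
    exact hK'
  have hftc (w : Heis n) : ∫ r in Set.Ioc (0 : ℝ) 1, F r w = u (hMul ξ (hDil 1 w)) - u ξ := by
    have hc : Continuous fun r ↦ F r w :=
      hFc.comp (f := fun r : ℝ ↦ (r, w)) (by fun_prop)
    rw [← intervalIntegral.integral_of_le zero_le_one,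
      intervalIntegral.integral_eq_sub_of_hasDerivAt
        (fun r _ ↦ hasDerivAt_comp_hMul_hDil hu ξ w r) (hc.intervalIntegrable _ _), hMul_hDil ξ 0]
    simp
  have hcu : Continuous fun w ↦ u (hMul ξ (hDil 1 w)) :=
    (contDiff_comp_hMul_hDil hu ξ 1).continuous
  have hrep : u ξ = (∫ w, φ w * u (hMul ξ (hDil 1 w))) -
      ∫ r in Set.Ioc (0 : ℝ) 1, ∫ w, φ w * F r w := by
    rw [integral_integral_swap hint]
    simp_rw [integral_const_mul, hftc, mul_sub]
    have hi : Integrable fun w ↦ φ w * u (hMul ξ (hDil 1 w)) :=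
      (hφ.continuous.mul hcu).integrable_of_hasCompactSupport hφc.mul_right
    rw [integral_sub hi
      ((hφ.continuous.integrable_of_hasCompactSupport hφc).mul_const _), integral_mul_const, hφ1]
    ring
  have hfst : ‖∫ w, φ w * u (hMul ξ (hDil 1 w))‖ₑ ≤
      ENNReal.ofReal M₂ * ballInt (fun w ↦ ‖u w‖ₑ) 1 ξ := by
    refine (enorm_integral_le_lintegral_enorm _).trans ?_
    rw [ballInt, ← lintegral_const_mul _ hcu.measurable.enorm,
      ← lintegral_indicator Metric.isClosed_closedBall.measurableSet]
    refine lintegral_mono fun w ↦ ?_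
    by_cases hw : w ∈ Metric.closedBall (0 : Heis n) 1
    · rw [Set.indicator_of_mem hw, enorm_mul]
      gcongr
      rw [← ofReal_norm]
      exact ENNReal.ofReal_le_ofReal (hM₂ w)
    · simp [h0 hw]
  have hsnd {r : ℝ} (hr : 0 < r) : ‖∫ w, φ w * F r w‖ₑ ≤
      ENNReal.ofReal M₁ * ballInt (fun w ↦ ENNReal.ofReal (hGradNorm u w)) r ξ := by
    have h := hest _ (contDiff_comp_hMul_hDil hu ξ r)
    simp_rw [fderiv_comp_hMul_hDil hu, hDiff_dilation, map_smul, smul_eq_mul,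
      hGradNorm_comp_hMul_hDil hu ξ hr.le, ENNReal.ofReal_mul hr.le, mul_left_comm _ r] at h
    have hm : Measurable fun w ↦ ENNReal.ofReal (hGradNorm u (hMul ξ (hDil r w))) :=
      ((continuous_hGradNorm hu).measurable.comp (measurable_hMul_hDil ξ r)).ennreal_ofReal
    rw [integral_const_mul, enorm_mul, lintegral_const_mul _ hm, mul_left_comm,
      Real.enorm_of_nonneg hr.le] at h
    exact (ENNReal.mul_le_mul_iff_right (by simpa using hr) ENNReal.ofReal_ne_top).1 h
  rw [hrep, mul_add]
  refine enorm_sub_le.trans (add_le_add ?_ ?_)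
  · refine hfst.trans ?_
    gcongr
    exact le_max_right _ _
  · have hmG : Measurable fun w ↦ ENNReal.ofReal (hGradNorm u w) :=
      (continuous_hGradNorm hu).measurable.ennreal_ofReal
    have hm : Measurable fun r ↦ ballInt (fun w ↦ ENNReal.ofReal (hGradNorm u w)) r ξ :=
      (measurable_ballInt hmG).comp (f := fun r ↦ (r, ξ)) (by fun_prop)
    refine (enorm_integral_le_lintegral_enorm _).trans ?_
    rw [← lintegral_const_mul _ hm]
    refine setLIntegral_mono (hm.const_mul _) fun r hr ↦ (hsnd hr.1).trans ?_
    gcongr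
    exact le_max_left _ _

lemma lintegral_ballInt_Ioc_rpow_le {n : ℕ} {q : ℝ} (hq : (2 * n + 2 : ℝ) ≤ q) :
    ∃ K : ℝ≥0∞, K ≠ ⊤ ∧ ∀ g : Heis n → ℝ≥0∞, Measurable g →
      ∫⁻ ξ, (∫⁻ r in Set.Ioc (0 : ℝ) 1, ballInt g r ξ) ^ q ≤
        K * (∫⁻ w, g w ^ (2 * n + 2 : ℝ)) ^ (q / (2 * n + 2)) := by
  have hn : (0 : ℝ) ≤ n := n.cast_nonneg
  obtain ⟨K, hK, hKb⟩ := exists_lintegral_Ioc_rpow_le (by linarith : (1 : ℝ) < 2 * n + 2) hq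
  set b := volume (Metric.closedBall (0 : Heis n) 1) ^ ((2 * n + 2 - 1) * q / (2 * n + 2) + 1)
  refine ⟨K * b, ENNReal.mul_ne_top hK (ENNReal.rpow_ne_top_of_nonneg ?_
    (volume_closedBall_lt_top n).ne), fun g hg ↦ ?_⟩
  · have : (0 : ℝ) ≤ (2 * n + 2 - 1) * q := mul_nonneg (by linarith) (by linarith)
    positivity
  set A := (∫⁻ w, g w ^ (2 * n + 2 : ℝ)) ^ (q / (2 * n + 2))
  have hm := measurable_ballInt hg
  have hmr (ξ : Heis n) : Measurable fun r ↦ ballInt g r ξ :=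
    hm.comp (f := fun r ↦ (r, ξ)) (by fun_prop)
  have hmξ (r : ℝ) : Measurable fun ξ ↦ ballInt g r ξ :=
    hm.comp (f := fun ξ ↦ (r, ξ)) (by fun_prop)
  have hmw : Measurable fun p : Heis n × ℝ ↦
      ENNReal.ofReal (p.2 ^ (q - (2 * n + 2))) * ballInt g p.2 p.1 ^ q := by
    have : Measurable fun p : Heis n × ℝ ↦ ballInt g p.2 p.1 := hm.comp measurable_swap
    fun_prop
  calc ∫⁻ ξ, (∫⁻ r in Set.Ioc (0 : ℝ) 1, ballInt g r ξ) ^ q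
      ≤ ∫⁻ ξ, K * ∫⁻ r in Set.Ioc (0 : ℝ) 1,
          ENNReal.ofReal (r ^ (q - (2 * n + 2))) * ballInt g r ξ ^ q :=
        lintegral_mono fun ξ ↦ hKb _ (hmr ξ)
    _ = K * ∫⁻ r in Set.Ioc (0 : ℝ) 1,
          ENNReal.ofReal (r ^ (q - (2 * n + 2))) * ∫⁻ ξ, ballInt g r ξ ^ q := by
        rw [lintegral_const_mul _ hmw.lintegral_prod_right', lintegral_lintegral_swap
          hmw.aemeasurable]
        congr 1
        refine lintegral_congr fun r ↦ ?_
        exact lintegral_const_mul (ENNReal.ofReal (r ^ (q - (2 * n + 2)))) ((hmξ r).pow_const q)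
    _ ≤ K * ∫⁻ r in Set.Ioc (0 : ℝ) 1, b * A := by
        gcongr K * ?_
        refine setLIntegral_mono measurable_const fun r hr ↦ ?_
        refine (mul_le_mul_right (lintegral_ballInt_rpow_le hg hq hr.1) _).trans_eq ?_
        rw [← mul_assoc, ← ENNReal.ofReal_mul (Real.rpow_nonneg hr.1.le _), ← Real.rpow_add hr.1]
        simp [b, A]
    _ = K * b * A := by
        simp [mul_assoc]

/-- Corollary 1.2: `W^{1,Q}(ℍ^n)` is continuously embedded in `L^q(ℍ^n)` for every `q ≥ Q`. -/
theorem sobolev_embedding_heisenberg (n : ℕ) (hn : 1 ≤ n) (q : ℝ) (hq : (2 * n + 2 : ℝ) ≤ q) :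
    ∃ C : ℝ, 0 < C ∧ ∀ u : Heis n → ℝ, ContDiff ℝ (⊤ : ℕ∞) u → HasCompactSupport u →
      (∫⁻ ξ, ENNReal.ofReal (|u ξ| ^ q)) ^ (1 / q) ≤
        ENNReal.ofReal C *
          (∫⁻ ξ, ENNReal.ofReal (hGradNorm u ξ ^ (2 * n + 2) + |u ξ| ^ (2 * n + 2)))
            ^ (1 / (2 * (n : ℝ) + 2)) := by
  have hn0 : (0 : ℝ) ≤ n := n.cast_nonneg
  have hq0 : 0 < q := by linarith
  have hqQ : 0 ≤ q / (2 * n + 2) := by positivity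
  obtain ⟨M, -, hM⟩ := exists_enorm_le_ballInt hn
  obtain ⟨K, hK, hKb⟩ := lintegral_ballInt_Ioc_rpow_le hq
  set b := volume (Metric.closedBall (0 : Heis n) 1) ^ ((2 * n + 2 - 1) * q / (2 * n + 2) + 1)
  have hb : b ≠ ⊤ := by
    refine ENNReal.rpow_ne_top_of_nonneg ?_ (volume_closedBall_lt_top n).ne
    have : (0 : ℝ) ≤ (2 * n + 2 - 1) * q := mul_nonneg (by linarith) hq0.le
    positivity
  set C := ENNReal.ofReal M * (b ^ (1 / q) + K ^ (1 / q)) with hC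
  have hC_top : C ≠ ⊤ := by
    have h1 := ENNReal.rpow_ne_top_of_nonneg (one_div_nonneg.2 hq0.le) hb
    have h2 := ENNReal.rpow_ne_top_of_nonneg (one_div_nonneg.2 hq0.le) hK
    finiteness
  refine ⟨C.toReal + 1, by positivity, fun u hu _ ↦ ?_⟩
  set T := ∫⁻ ξ, ENNReal.ofReal (hGradNorm u ξ ^ (2 * n + 2) + |u ξ| ^ (2 * n + 2))
  set G : Heis n → ℝ≥0∞ := fun w ↦ ENNReal.ofReal (hGradNorm u w) with hGdef
  have hG0 (w : Heis n) : 0 ≤ hGradNorm u w := Real.sqrt_nonneg _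
  have hmG : Measurable G := (continuous_hGradNorm hu).measurable.ennreal_ofReal
  have hmu : Measurable fun w ↦ ‖u w‖ₑ := hu.continuous.measurable.enorm
  have hcast (x : ℝ≥0∞) : x ^ (2 * n + 2 : ℝ) = x ^ (2 * n + 2) := by
    rw [← ENNReal.rpow_natCast]; norm_cast
  have hAG : ∫⁻ w, G w ^ (2 * n + 2 : ℝ) ≤ T := by
    refine lintegral_mono fun w ↦ ?_
    rw [hcast, hGdef, ← ENNReal.ofReal_pow (hG0 w)]
    exact ENNReal.ofReal_le_ofReal (le_add_of_nonneg_right (by positivity))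
  have hAu : ∫⁻ w, ‖u w‖ₑ ^ (2 * n + 2 : ℝ) ≤ T := by
    refine lintegral_mono fun w ↦ ?_
    rw [hcast, Real.enorm_eq_ofReal_abs, ← ENNReal.ofReal_pow (abs_nonneg _)]
    exact ENNReal.ofReal_le_ofReal (le_add_of_nonneg_left (pow_nonneg (hG0 w) _))
  have hroot {c A : ℝ≥0∞} {I : ℝ≥0∞} (hA : A ≤ T) (hI : I ≤ c * A ^ (q / (2 * n + 2))) :
      I ^ (1 / q) ≤ c ^ (1 / q) * T ^ (1 / (2 * (n : ℝ) + 2)) := by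
    refine (ENNReal.rpow_le_rpow hI (one_div_nonneg.2 hq0.le)).trans ?_
    rw [ENNReal.mul_rpow_of_nonneg _ _ (one_div_nonneg.2 hq0.le), ← ENNReal.rpow_mul,
      div_mul_div_comm, mul_one, mul_comm (2 * (n : ℝ) + 2) q, ← div_div, div_self hq0.ne']
    gcongr
  have h1 : ∫⁻ ξ, ballInt (fun w ↦ ‖u w‖ₑ) 1 ξ ^ q ≤
      b * (∫⁻ w, ‖u w‖ₑ ^ (2 * n + 2 : ℝ)) ^ (q / (2 * n + 2)) := by
    simpa using lintegral_ballInt_rpow_le hmu hq one_pos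
  have hm1 : Measurable fun ξ ↦ ballInt (fun w ↦ ‖u w‖ₑ) 1 ξ :=
    (measurable_ballInt hmu).comp (f := fun ξ ↦ (1, ξ)) (by fun_prop)
  have hm2 : Measurable fun ξ ↦ ∫⁻ r in Set.Ioc (0 : ℝ) 1, ballInt G r ξ :=
    ((measurable_ballInt hmG).comp measurable_swap).lintegral_prod_right'
  have hm12 : Measurable fun ξ ↦ ballInt (fun w ↦ ‖u w‖ₑ) 1 ξ +
      ∫⁻ r in Set.Ioc (0 : ℝ) 1, ballInt G r ξ := hm1.add hm2
  calc (∫⁻ ξ, ENNReal.ofReal (|u ξ| ^ q)) ^ (1 / q)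
      ≤ (∫⁻ ξ, ENNReal.ofReal M ^ q * (ballInt (fun w ↦ ‖u w‖ₑ) 1 ξ +
          ∫⁻ r in Set.Ioc (0 : ℝ) 1, ballInt G r ξ) ^ q) ^ (1 / q) := by
        refine ENNReal.rpow_le_rpow (lintegral_mono fun ξ ↦ ?_) (one_div_nonneg.2 hq0.le)
        rw [← ENNReal.ofReal_rpow_of_nonneg (abs_nonneg _) hq0.le, ← Real.enorm_eq_ofReal_abs,
          ← ENNReal.mul_rpow_of_nonneg _ _ hq0.le]
        exact ENNReal.rpow_le_rpow (hM u hu ξ) hq0.le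
    _ = ENNReal.ofReal M * (∫⁻ ξ, (ballInt (fun w ↦ ‖u w‖ₑ) 1 ξ +
          ∫⁻ r in Set.Ioc (0 : ℝ) 1, ballInt G r ξ) ^ q) ^ (1 / q) := by
        rw [lintegral_const_mul _ (hm12.pow_const q),
          ENNReal.mul_rpow_of_nonneg _ _ (one_div_nonneg.2 hq0.le), ← ENNReal.rpow_mul,
          mul_one_div_cancel hq0.ne', ENNReal.rpow_one]
    _ ≤ ENNReal.ofReal M * (b ^ (1 / q) * T ^ (1 / (2 * (n : ℝ) + 2)) +
          K ^ (1 / q) * T ^ (1 / (2 * (n : ℝ) + 2))) := by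
        gcongr
        refine (ENNReal.lintegral_Lp_add_le hm1.aemeasurable hm2.aemeasurable
          (by linarith)).trans ?_
        exact add_le_add (hroot hAu h1) (hroot hAG (hKb G hmG))
    _ = C * T ^ (1 / (2 * (n : ℝ) + 2)) := by rw [hC]; ring
    _ ≤ ENNReal.ofReal (C.toReal + 1) * T ^ (1 / (2 * (n : ℝ) + 2)) := by
        gcongr
        rw [← ENNReal.ofReal_toReal hC_top]
        exact ENNReal.ofReal_le_ofReal (by simp)
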